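/- The subgroup of GL(3, ℚ) generated by R₁ and T is isomorphic, as an abstract group, to the direct product PSL(2, ℤ) × (ℤ/2ℤ); that is, the monodromy group of the quantum cohomology of CP² is isomorphic to ⟨X, Y | X² = Y³ = 1⟩ × C₂ ≅ PSL(2, ℤ) × C₂. -/

import Mathlib

open Matrix
open scoped MatrixGroups

/-- The symmetric square of the standard representation of `SL(2, R)`, in the basis
`e₁², 2e₁e₂, e₂²`. -/
def symSquare (R : Type*) [CommRing R] :
    SpecialLinearGroup (Fin 2) R →* Matrix (Fin 3) (Fin 3) R where
  toFun g := !![g 0 0 ^ 2, 2 * g 0 0 * g 0 1, g 0 1 ^ 2;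
    g 0 0 * g 1 0, g 0 0 * g 1 1 + g 0 1 * g 1 0, g 0 1 * g 1 1;
    g 1 0 ^ 2, 2 * g 1 0 * g 1 1, g 1 1 ^ 2]
  map_one' := by
    ext i j
    fin_cases i <;> fin_cases j <;> simp
  map_mul' g h := by
    ext i j
    fin_cases i <;> fin_cases j <;>
      simp [Matrix.mul_apply, Fin.sum_univ_succ] <;> ring

theorem symSquare_apply {R : Type*} [CommRing R] (g : SpecialLinearGroup (Fin 2) R) :
    symSquare R g = !![g 0 0 ^ 2, 2 * g 0 0 * g 0 1, g 0 1 ^ 2;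
      g 0 0 * g 1 0, g 0 0 * g 1 1 + g 0 1 * g 1 0, g 0 1 * g 1 1;
      g 1 0 ^ 2, 2 * g 1 0 * g 1 1, g 1 1 ^ 2] := rfl

theorem symSquare_eq_one_iff {R : Type*} [CommRing R] [IsDomain R]
    (g : SpecialLinearGroup (Fin 2) R) :
    symSquare R g = 1 ↔ g ∈ Subgroup.center (SpecialLinearGroup (Fin 2) R) := by
  rw [Matrix.SpecialLinearGroup.mem_center_iff, symSquare_apply]
  constructor
  · intro h
    have h00 : g 0 0 ^ 2 = 1 := by simpa using congrFun₂ h 0 0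
    have h01 : g 0 1 = 0 := by simpa using congrFun₂ h 0 2
    have h10 : g 1 0 = 0 := by simpa using congrFun₂ h 2 0
    have h11 : g 0 0 * g 1 1 = 1 := by simpa [h01] using congrFun₂ h 1 1
    have heq : g 0 0 = g 1 1 := by linear_combination g 1 1 * h00 - g 0 0 * h11
    refine ⟨g 0 0, by simpa using h00, ?_⟩
    ext i j
    fin_cases i <;> fin_cases j <;> simp [h01, h10, heq]
  · rintro ⟨r, hr, h⟩
    have hr : r ^ 2 = 1 := by simpa using hr
    have hg (i j : Fin 2) : g i j = scalar (Fin 2) r i j := congrFun₂ h.symm i j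
    ext i j
    fin_cases i <;> fin_cases j <;> simp [hg, hr, ← sq]

theorem symSquare_int_ne_neg_one (g : SL(2, ℤ)) : symSquare ℤ g ≠ -1 := by
  intro h
  have h00 : g 0 0 ^ 2 = -1 := by simpa [symSquare_apply] using congrFun₂ h 0 0
  nlinarith [sq_nonneg (g 0 0)]

/-- The symmetric square representation of `PSL(2, ℤ)` on `ℚ³`. -/
noncomputable def pslSymSquare : PSL(2, ℤ) →* GL (Fin 3) ℚ :=
  QuotientGroup.lift _
    ((GeneralLinearGroup.map (Int.castRingHom ℚ)).comp (symSquare ℤ).toHomUnits)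
    fun g hg ↦ by
      have : (symSquare ℤ).toHomUnits g = 1 := Units.ext ((symSquare_eq_one_iff g).2 hg)
      simp [this]

theorem coe_pslSymSquare_mk (g : SL(2, ℤ)) :
    (pslSymSquare (QuotientGroup.mk g) : Matrix (Fin 3) (Fin 3) ℚ) =
      (symSquare ℤ g).map (Int.cast : ℤ → ℚ) := rfl

theorem pslSymSquare_injective : Function.Injective pslSymSquare := by
  rw [injective_iff_map_eq_one]
  intro x
  induction x using QuotientGroup.induction_on with | _ g => ?_
  intro h
  rw [QuotientGroup.eq_one_iff, ← symSquare_eq_one_iff]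
  refine Matrix.map_injective (Int.cast_injective (α := ℚ)) ?_
  beta_reduce
  rw [← coe_pslSymSquare_mk, h]
  simp

theorem pslSymSquare_ne_neg_one (x : PSL(2, ℤ)) : pslSymSquare x ≠ -1 := by
  induction x using QuotientGroup.induction_on with | _ g => ?_
  intro h
  refine symSquare_int_ne_neg_one g (Matrix.map_injective (Int.cast_injective (α := ℚ)) ?_)
  beta_reduce
  rw [← coe_pslSymSquare_mk, h]
  ext i j
  fin_cases i <;> fin_cases j <;> simp

theorem range_pslSymSquare : pslSymSquare.range =
    Subgroup.closure {pslSymSquare (QuotientGroup.mk ModularGroup.S),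
      pslSymSquare (QuotientGroup.mk ModularGroup.T)} := by
  have hmk : (QuotientGroup.mk' (Subgroup.center SL(2, ℤ))).range = ⊤ :=
    MonoidHom.range_eq_top.2 (QuotientGroup.mk'_surjective _)
  rw [MonoidHom.range_eq_map, ← hmk, MonoidHom.range_eq_map,
    ← SpecialLinearGroup.SL2Z_generators, MonoidHom.map_closure, MonoidHom.map_closure,
    Set.image_pair, Set.image_pair]
  rfl

/-- The inclusion of the scalars `±1` into `GL(3, ℚ)`. -/
noncomputable def signScalar : ℤˣ →* GL (Fin 3) ℚ :=
  Units.map (Int.castRingHom (Matrix (Fin 3) (Fin 3) ℚ)).toMonoidHom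

theorem signScalar_neg_one : signScalar (-1) = -1 := by
  ext1; simp [signScalar]

/-- The columns are the images of `e₁², 2e₁e₂, e₂²` in the basis in which the monodromy matrices
are given. -/
noncomputable def symSquareBasis : GL (Fin 3) ℚ :=
  GeneralLinearGroup.mkOfDetNeZero !![1, -3, 1; -1, -1, 1; 1, -1, -1] (by
    simp [det_fin_three]; norm_num)

/-- The representation of `PSL(2, ℤ) × {±1}` whose image is the monodromy group. -/
noncomputable def monodromyRep : PSL(2, ℤ) × ℤˣ →* GL (Fin 3) ℚ :=
  ((MulAut.conj symSquareBasis).toMonoidHom.comp pslSymSquare).noncommCoprod signScalar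
    fun x e ↦ by
      obtain rfl | rfl := Int.units_eq_one_or e
      · simp
      · rw [signScalar_neg_one]
        exact (Commute.one_right _).neg_right

theorem monodromyRep_injective : Function.Injective monodromyRep := by
  rw [injective_iff_map_eq_one]
  rintro ⟨x, e⟩ h
  obtain rfl | rfl := Int.units_eq_one_or e
  · have : pslSymSquare x = 1 := by simpa [monodromyRep] using h
    rw [(injective_iff_map_eq_one _).1 pslSymSquare_injective x this]
    rfl
  · refine absurd ?_ (pslSymSquare_ne_neg_one x)
    have : MulAut.conj symSquareBasis (pslSymSquare x) = -1 := by
      simpa [monodromyRep, signScalar_neg_one, neg_eq_iff_eq_neg] using h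
    apply (MulAut.conj symSquareBasis).injective
    rw [this]
    simp

theorem conj_pslSymSquare_mk_eq {g : SL(2, ℤ)} {A : GL (Fin 3) ℚ}
    (h : !![1, -3, 1; -1, -1, 1; 1, -1, -1] * (symSquare ℤ g).map (Int.cast : ℤ → ℚ) =
      (A : Matrix (Fin 3) (Fin 3) ℚ) * !![1, -3, 1; -1, -1, 1; 1, -1, -1]) :
    MulAut.conj symSquareBasis (pslSymSquare (QuotientGroup.mk g)) = A := by
  rw [MulAut.conj_apply, mul_inv_eq_iff_eq_mul]
  exact Units.ext h

theorem range_monodromyRep (R₁ T : GL (Fin 3) ℚ)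
    (hR : (R₁ : Matrix (Fin 3) (Fin 3) ℚ) = !![-1, 3, 3; 0, 1, 0; 0, 0, 1])
    (hT : (T : Matrix (Fin 3) (Fin 3) ℚ) = !![0, 0, 1; -1, 3, 3; 0, -1, 0]) :
    monodromyRep.range = Subgroup.closure {R₁, T} := by
  have hS' : MulAut.conj symSquareBasis (pslSymSquare (QuotientGroup.mk ModularGroup.S)) =
      -R₁ := by
    refine conj_pslSymSquare_mk_eq ?_
    rw [Units.val_neg, hR, symSquare_apply]
    ext i j
    fin_cases i <;> fin_cases j <;>
      simp [ModularGroup.S, Matrix.mul_apply, Fin.sum_univ_succ]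
  have hT' : MulAut.conj symSquareBasis (pslSymSquare (QuotientGroup.mk ModularGroup.T)) =
      T := by
    refine conj_pslSymSquare_mk_eq ?_
    rw [hT, symSquare_apply]
    ext i j
    fin_cases i <;> fin_cases j <;>
      simp [ModularGroup.T, Matrix.mul_apply, Fin.sum_univ_succ] <;> norm_num
  have hcube : (R₁ * T) ^ 3 = -1 := by
    ext i j
    simp only [Units.val_mul, Units.val_neg, hR, hT, pow_succ, pow_zero, one_mul]
    fin_cases i <;> fin_cases j <;> simp [Matrix.mul_apply, Fin.sum_univ_succ] <;> norm_num
  have hrange : monodromyRep.range = Subgroup.closure {-R₁, T} ⊔ signScalar.range := by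
    rw [monodromyRep, MonoidHom.noncommCoprod_range, MonoidHom.range_comp, range_pslSymSquare,
      MonoidHom.map_closure, Set.image_pair]
    simp only [MulEquiv.toMonoidHom_eq_coe, MonoidHom.coe_coe, hS', hT']
  have hR_mem : R₁ ∈ Subgroup.closure {R₁, T} := Subgroup.subset_closure (by simp)
  have hT_mem : T ∈ Subgroup.closure {R₁, T} := Subgroup.subset_closure (by simp)
  have hneg : -1 ∈ Subgroup.closure {R₁, T} := hcube ▸ pow_mem (mul_mem hR_mem hT_mem) 3
  rw [hrange]
  apply le_antisymm
  · refine sup_le ((Subgroup.closure_le _).2 ?_) ?_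
    · rintro _ (rfl | rfl)
      · simpa using mul_mem hneg hR_mem
      · exact hT_mem
    · rintro _ ⟨e, rfl⟩
      obtain rfl | rfl := Int.units_eq_one_or e
      · simp
      · rwa [signScalar_neg_one]
  · refine (Subgroup.closure_le _).2 ?_
    rintro _ (h | rfl)
    · rw [h]
      have hmem := Subgroup.mul_mem_sup (Subgroup.subset_closure (Set.mem_insert (-R₁) {T}))
        (show -1 ∈ signScalar.range from ⟨-1, signScalar_neg_one⟩)
      simpa using hmem
    · exact Subgroup.mem_sup_left (Subgroup.subset_closure (by simp))

/-- **Theorem 3 of the paper, case of `CP²`.** The monodromy group of the quantum cohomology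
of `CP²`, i.e. the subgroup of `GL(3,ℚ)` generated by the reflection `R₁` and the matrix `T`,
is isomorphic to `PSL(2,ℤ) × C₂`, where `PSL(2,ℤ) = SL(2,ℤ)/{±1}` and `C₂` is cyclic of
order two. -/
theorem monodromy_group_CP2 (R₁ T : GL (Fin 3) ℚ)
    (hR : (R₁ : Matrix (Fin 3) (Fin 3) ℚ) = !![-1, 3, 3; 0, 1, 0; 0, 0, 1])
    (hT : (T : Matrix (Fin 3) (Fin 3) ℚ) = !![0, 0, 1; -1, 3, 3; 0, -1, 0]) :
    Nonempty ((Subgroup.closure {R₁, T} : Subgroup (GL (Fin 3) ℚ)) ≃*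
      PSL(2, ℤ) × Multiplicative (ZMod 2)) := by
  have : Fact (Nat.Prime 2) := ⟨Nat.prime_two⟩
  have sign : ℤˣ ≃* Multiplicative (ZMod 2) :=
    mulEquivOfPrimeCardEq (p := 2) (by simp) (by simp)
  exact ⟨(MulEquiv.subgroupCongr (range_monodromyRep R₁ T hR hT)).symm.trans
    ((MonoidHom.ofInjective monodromyRep_injective).symm.trans
      ((MulEquiv.refl _).prodCongr sign))⟩
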